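/- arXiv:1101.1112 — 2 statements merged into one kernel-verified Lean document; each statement's English description precedes it below -/
import Mathlib

section
/- Let R be a commutative ring, A an associative unital R-algebra, M a two-sided Mathieu subspace of A, and a ∈ A an element that is co-integral over R. Then a lies in the radical r(M) if and only if there exists N ∈ ℕ such that the two-sided ideal of A generated by a^N is contained in M. -/
/-- `M` is a two-sided Mathieu subspace of the `R`-algebra `A`. -/
def IsMathieuTS {R A : Type*} [CommRing R] [Ring A] [Algebra R A] (M : Submodule R A) : Prop :=
  ∀ a b c : A, (∀ m : ℕ, 1 ≤ m → a ^ m ∈ M) →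
    ∃ N : ℕ, ∀ m : ℕ, N ≤ m → b * a ^ m * c ∈ M

/-- The radical of a set: elements all of whose sufficiently large powers lie in the set. -/
def radSet {A : Type*} [Monoid A] (S : Set A) : Set A :=
  {a | ∃ N : ℕ, ∀ m : ℕ, N ≤ m → a ^ m ∈ S}

/-- `a` is co-integral over `R`. -/
def CoIntegral (R : Type*) {A : Type*} [CommRing R] [Ring A] [Algebra R A] (a : A) : Prop :=
  ∃ (N : ℕ) (p : Polynomial R), a ^ N = a ^ (N + 1) * Polynomial.aeval a p

open Polynomial in
/-- A co-integral element admits, for every sufficiently large `K`, an idempotent multiple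
`a ^ K * q(a)` fixing `a ^ K`. -/
theorem CoIntegral.exists_idempotent {R A : Type*} [CommRing R] [Ring A] [Algebra R A] {a : A}
    (ha : CoIntegral R a) :
    ∃ N : ℕ, ∀ K : ℕ, N ≤ K → ∃ q : R[X],
      a ^ K * (a ^ K * aeval a q) = a ^ K ∧ IsIdempotentElem (a ^ K * aeval a q) := by
  obtain ⟨N, p, hp⟩ := ha
  refine ⟨N, fun K hK => ⟨p ^ K, ?_⟩⟩
  have hstep : a ^ K * (a * aeval a p) = a ^ K := by
    obtain ⟨d, rfl⟩ := Nat.exists_eq_add_of_le' hK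
    rw [pow_add, mul_assoc, ← mul_assoc (a ^ N), ← pow_succ, ← hp]
  have hcomm : Commute a (aeval a p) := by
    simpa using ((Commute.all (X : R[X]) p).map (aeval a))
  have hpow : ∀ k : ℕ, a ^ K * (a * aeval a p) ^ k = a ^ K := by
    intro k
    induction k with
    | zero => simp
    | succ k ih => rw [pow_succ, ← mul_assoc, ih, hstep]
  have hfix : a ^ K * (a ^ K * aeval a (p ^ K)) = a ^ K := by
    rw [map_pow, ← hcomm.mul_pow, hpow]
  refine ⟨hfix, ?_⟩
  have hcomm' : Commute (aeval a (p ^ K)) (a ^ K) := by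
    rw [map_pow]
    exact (hcomm.pow_pow K K).symm
  calc a ^ K * aeval a (p ^ K) * (a ^ K * aeval a (p ^ K))
      = aeval a (p ^ K) * (a ^ K * (a ^ K * aeval a (p ^ K))) := by
        rw [← hcomm'.eq, mul_assoc]
    _ = a ^ K * aeval a (p ^ K) := by rw [hfix, hcomm'.eq]

open Polynomial in
/-- If all powers of `a` from `K` on lie in a submodule, so do all multiples `a ^ K * q(a)`. -/
theorem Submodule.pow_mul_aeval_mem {R A : Type*} [CommRing R] [Ring A] [Algebra R A]
    {M : Submodule R A} {a : A} {K : ℕ} (h : ∀ m, K ≤ m → a ^ m ∈ M) (q : R[X]) :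
    a ^ K * aeval a q ∈ M := by
  rw [aeval_eq_sum_range, Finset.mul_sum]
  refine M.sum_mem fun i _ => ?_
  rw [mul_smul_comm, ← pow_add]
  exact M.smul_mem _ (h _ (Nat.le_add_right K i))

/-- A two-sided Mathieu subspace contains the ideal generated by each of its idempotents. -/
theorem IsMathieuTS.mul_idempotent_mul_mem {R A : Type*} [CommRing R] [Ring A] [Algebra R A]
    {M : Submodule R A} (hM : IsMathieuTS M) {e : A} (he : IsIdempotentElem e) (heM : e ∈ M)
    (b c : A) : b * e * c ∈ M := by
  have hpow : ∀ m : ℕ, 1 ≤ m → e ^ m = e := fun m hm => he.pow_eq (by lia)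
  obtain ⟨N, hN⟩ := hM e b c fun m hm => (hpow m hm).symm ▸ heM
  simpa [hpow (N + 1) (by lia)] using hN (N + 1) (by lia)

theorem mem_radical_iff_ideal_pow_subset {R A : Type*} [CommRing R] [Ring A] [Algebra R A]
    (M : Submodule R A) (hM : IsMathieuTS M) (a : A) (ha : CoIntegral R a) :
    a ∈ radSet (M : Set A) ↔
      ∃ N : ℕ, ((TwoSidedIdeal.span {a ^ N} : TwoSidedIdeal A) : Set A) ⊆ (M : Set A) := by
  constructor
  · rintro ⟨N₀, hN₀⟩
    obtain ⟨N, hN⟩ := ha.exists_idempotent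
    obtain ⟨q, hfix, hidem⟩ := hN (max N N₀) (le_max_left _ _)
    set K := max N N₀
    have heM : a ^ K * Polynomial.aeval a q ∈ M :=
      Submodule.pow_mul_aeval_mem (fun m hm => hN₀ m ((le_max_right _ _).trans hm)) q
    refine ⟨K, fun x hx => ?_⟩
    rw [SetLike.mem_coe, TwoSidedIdeal.mem_span_iff_mem_addSubgroup_closure] at hx
    induction hx using AddSubgroup.closure_induction with
    | mem x hx =>
      obtain ⟨y, ⟨b, -, z, rfl, rfl⟩, c, -, rfl⟩ := hx
      have hmem := hM.mul_idempotent_mul_mem hidem heM (b * a ^ K) c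
      rwa [mul_assoc b, hfix] at hmem
    | zero => exact M.zero_mem
    | add x y _ _ hx hy => exact M.add_mem hx hy
    | neg x _ hx => exact M.neg_mem hx
  · rintro ⟨N, hN⟩
    refine ⟨N, fun m hm => hN ?_⟩
    obtain ⟨d, rfl⟩ := Nat.exists_eq_add_of_le' hm
    rw [pow_add]
    exact TwoSidedIdeal.mul_mem_left _ _ _ (TwoSidedIdeal.subset_span rfl)
end

section
/- Let R be a commutative ring, A a commutative unital R-algebra, and V an R-submodule of A such that every element of the radical r(V) lies in the ideal of A generated by the co-integral elements of r(V). Then V is a Mathieu subspace of A if and only if r(V) is an ideal of A. -/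
/-- `M` is a Mathieu subspace of the commutative `R`-algebra `A`. -/
def IsMathieu {R A : Type*} [CommRing R] [CommRing A] [Algebra R A] (M : Submodule R A) : Prop :=
  ∀ a b : A, (∀ m : ℕ, 1 ≤ m → a ^ m ∈ M) →
    ∃ N : ℕ, ∀ m : ℕ, N ≤ m → b * a ^ m ∈ M

section

variable {R A : Type*} [CommRing R] [CommRing A] [Algebra R A]

/-- The largest ideal of `A` contained in the submodule `V`. -/
def Submodule.idealCore (V : Submodule R A) : Ideal A where
  carrier := {x | ∀ b : A, b * x ∈ V}
  zero_mem' b := by simp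
  add_mem' hx hy b := by
    rw [mul_add]
    exact V.add_mem (hx b) (hy b)
  smul_mem' c x hx b := by
    rw [smul_eq_mul, ← mul_assoc]
    exact hx (b * c)

theorem Submodule.mem_idealCore {V : Submodule R A} {x : A} :
    x ∈ V.idealCore ↔ ∀ b : A, b * x ∈ V :=
  Iff.rfl

theorem Submodule.pow_mul_aeval_mem_s12 {V : Submodule R A} {a : A} {n : ℕ}
    (h : ∀ m, n ≤ m → a ^ m ∈ V) (p : Polynomial R) : a ^ n * Polynomial.aeval a p ∈ V := by
  rw [Polynomial.aeval_eq_sum_range, Finset.mul_sum]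
  refine V.sum_mem fun i _ => ?_
  rw [mul_smul_comm, ← pow_add]
  exact V.smul_mem _ (h _ (Nat.le_add_right n i))

theorem CoIntegral.exists_isIdempotentElem_mem {V : Submodule R A} {a : A}
    (hc : CoIntegral R a) (ha : a ∈ radSet (V : Set A)) :
    ∃ e ∈ V, IsIdempotentElem e ∧ ∃ n : ℕ, a ^ n * e = a ^ n := by
  obtain ⟨n, p, hp⟩ := hc
  obtain ⟨M, hM⟩ := ha
  set q := Polynomial.aeval a p with hq
  have absorb (k : ℕ) : a ^ n * (a * q) ^ k = a ^ n := by
    induction k with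
    | zero => simp
    | succ k ih =>
      calc a ^ n * (a * q) ^ (k + 1) = a ^ n * (a * q) ^ k * (a * q) := by ring
        _ = a ^ (n + 1) * q := by rw [ih]; ring
        _ = a ^ n := hp.symm
  have absorb_mul (k : ℕ) : (a * q) ^ n * (a * q) ^ k = (a * q) ^ n :=
    calc (a * q) ^ n * (a * q) ^ k = a ^ n * (a * q) ^ k * q ^ n := by ring
      _ = (a * q) ^ n := by rw [absorb, mul_pow]
  refine ⟨(a * q) ^ n, ?_, absorb_mul n, n, absorb n⟩
  have key : (a * q) ^ n = a ^ M * Polynomial.aeval a (Polynomial.X ^ n * p ^ (n + M)) := by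
    simp only [map_mul, map_pow, Polynomial.aeval_X, ← hq]
    rw [← absorb_mul M]
    ring
  rw [key]
  exact V.pow_mul_aeval_mem_s12 hM _

/-- If `e` acts as the identity on `b` and both `b` and `e + b` have all large powers in `V`,
then `b` lies in `V`. -/
theorem Submodule.mem_of_mem_radSet_of_add_mem_radSet {V : Submodule R A} {e b : A}
    (he : IsIdempotentElem e) (hbe : b * e = b) (hb : b ∈ radSet (V : Set A))
    (heb : e + b ∈ radSet (V : Set A)) : b ∈ V := by
  obtain ⟨K, hK⟩ := hb
  obtain ⟨n, hn⟩ := heb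
  have mul_mem (j : ℕ) : ∀ m, n + 1 ≤ m → b ^ j * (e + b) ^ m ∈ V := by
    induction j with
    | zero => exact fun m hm => by simpa using hn m (by omega)
    | succ j ih =>
      intro m hm
      obtain ⟨m, rfl⟩ : ∃ l, m = l + 1 := ⟨m - 1, by omega⟩
      have h : b ^ (j + 1) * (e + b) ^ (m + 1) =
          b ^ j * (e + b) ^ (m + 1 + 1) - b ^ j * (e + b) ^ (m + 1) := by
        have h' : (e + b) * e = e + b := by rw [add_mul, he.eq, hbe]
        linear_combination (-(b ^ j * (e + b) ^ m)) * h'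
      rw [h]
      exact V.sub_mem (ih _ (by omega)) (ih _ hm)
  have mul_pow_eq (j m : ℕ) : b ^ (j + 1) * (e + b) ^ m = b ^ (j + 1) * (1 + b) ^ m := by
    induction m with
    | zero => simp
    | succ m ih =>
      linear_combination (1 + b) * ih + b ^ j * (e + b) ^ m * hbe
  have descend (j : ℕ) (h : ∀ k, j + 2 ≤ k → b ^ k ∈ V) : b ^ (j + 1) ∈ V := by
    have h₁ := mul_mem (j + 1) (n + 1) le_rfl
    rw [mul_pow_eq, add_comm 1 b, add_pow, Finset.sum_range_succ', mul_add, Finset.mul_sum] at h₁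
    simp only [pow_zero, one_pow, mul_one, Nat.choose_zero_right, Nat.cast_one] at h₁
    refine (V.add_mem_iff_right (V.sum_mem fun i _ => ?_)).1 h₁
    rw [← mul_assoc, ← pow_add, mul_comm, ← nsmul_eq_mul]
    exact V.nsmul_mem (h _ (by omega)) _
  have all (d : ℕ) : ∀ j, K ≤ j + 1 + d → b ^ (j + 1) ∈ V := by
    induction d with
    | zero => exact fun j hj => hK _ hj
    | succ d ih =>
      refine fun j hj => descend j fun k hk => ?_
      obtain ⟨k, rfl⟩ : ∃ l, k = l + 1 := ⟨k - 1, by omega⟩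
      exact ih k (by omega)
  simpa using all K 0 (by omega)

theorem IsIdempotentElem.mem_radSet {V : Submodule R A} {e : A} (he : IsIdempotentElem e)
    (hV : e ∈ V) : e ∈ radSet (V : Set A) := by
  refine ⟨1, fun m hm => ?_⟩
  rwa [he.pow_eq (by omega)]

theorem IsMathieu.mem_idealCore {V : Submodule R A} (hM : IsMathieu V) {e : A}
    (he : IsIdempotentElem e) (hV : e ∈ V) : e ∈ V.idealCore := by
  intro b
  obtain ⟨n, hn⟩ := hM e b fun m hm => by rwa [he.pow_eq (by omega)]
  simpa [he.pow_succ_eq] using hn (n + 1) (by omega)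

theorem Submodule.mem_idealCore_of_radSet_eq {V : Submodule R A} {I : Ideal A}
    (hI : (I : Set A) = radSet (V : Set A)) {e : A} (he : IsIdempotentElem e) (hV : e ∈ V) :
    e ∈ V.idealCore := by
  intro b
  have heI : e ∈ I := by
    rw [← SetLike.mem_coe, hI]
    exact he.mem_radSet hV
  have hbI : b * e ∈ I := I.mul_mem_left b heI
  refine V.mem_of_mem_radSet_of_add_mem_radSet he (by rw [mul_assoc, he.eq]) ?_ ?_ <;> rw [← hI]
  exacts [hbI, I.add_mem heI hbI]

theorem Submodule.exists_forall_mul_pow_mem {V : Submodule R A} {a : A}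
    (ha : a ∈ V.idealCore.radical) : ∃ n : ℕ, ∀ m, n ≤ m → ∀ b : A, b * a ^ m ∈ V := by
  obtain ⟨n, hn⟩ := ha
  exact ⟨n, fun m hm => Submodule.mem_idealCore.1 (V.idealCore.pow_mem_of_pow_mem hn hm)⟩

theorem Submodule.radSet_subset_radical_idealCore {V : Submodule R A}
    (hG : ∀ a ∈ radSet (V : Set A),
      a ∈ Ideal.span {x : A | x ∈ radSet (V : Set A) ∧ CoIntegral R x})
    (hV : ∀ e ∈ V, IsIdempotentElem e → e ∈ V.idealCore) :
    radSet (V : Set A) ⊆ V.idealCore.radical := by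
  intro a ha
  refine Ideal.span_le.2 ?_ (hG a ha)
  rintro x ⟨hx, hc⟩
  obtain ⟨e, heV, he, n, hn⟩ := hc.exists_isIdempotentElem_mem hx
  refine ⟨n, ?_⟩
  rw [← hn]
  exact V.idealCore.mul_mem_left _ (hV e heV he)

end

theorem mathieu_iff_radical_is_ideal {R A : Type*} [CommRing R] [CommRing A] [Algebra R A]
    (V : Submodule R A)
    (hG : ∀ a ∈ radSet (V : Set A),
      a ∈ Ideal.span {x : A | x ∈ radSet (V : Set A) ∧ CoIntegral R x}) :
    IsMathieu V ↔ ∃ I : Ideal A, (I : Set A) = radSet (V : Set A) := by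
  constructor
  · intro hM
    refine ⟨V.idealCore.radical, Set.Subset.antisymm (fun a ha => ?_)
      (Submodule.radSet_subset_radical_idealCore hG fun e heV he => hM.mem_idealCore he heV)⟩
    obtain ⟨n, hn⟩ := Submodule.exists_forall_mul_pow_mem ha
    exact ⟨n, fun m hm => by simpa using hn m hm 1⟩
  · rintro ⟨I, hI⟩ a b ha
    obtain ⟨n, hn⟩ := Submodule.exists_forall_mul_pow_mem
      (Submodule.radSet_subset_radical_idealCore hG
        (fun e heV he => Submodule.mem_idealCore_of_radSet_eq hI he heV) ⟨1, ha⟩)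
    exact ⟨n, fun m hm => hn m hm b⟩
end
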